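/- arXiv:2111.02969 — 9 statements merged into one kernel-verified Lean document; each statement's English description precedes it below -/
import Mathlib

section
/- Fix j in Fin s and λ : Fin s → ℂ with pairwise distinct values. For n×n complex matrices ω and A, the commutator equation Λω − ωΛ = (E j)A − A(E j) holds if and only if for every pair of indices i, k with π(i) ≠ π(k) one has ω_{ik} = ((if π(i)=j then 1 else 0) − (if π(k)=j then 1 else 0)) · A_{ik} / (λ(π(i)) − λ(π(k))), with no constraint on the entries ω_{ik} for which π(i) = π(k). Equivalently, ω solves the equation iff ω = (ω j) + D for some matrix D whose entries vanish whenever π(i) ≠ π(k). -/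
open Matrix

/-- The diagonal matrix `Λ` with `Λ_{ii} = λ(π(i))`. -/
noncomputable def LamM {n s : ℕ} (bk : Fin n → Fin s) (lam : Fin s → ℂ) :
    Matrix (Fin n) (Fin n) ℂ :=
  Matrix.diagonal fun i => lam (bk i)

/-- The diagonal matrix `E j` with `(E j)_{ii} = 1` if `π(i) = j` and `0` otherwise. -/
noncomputable def EM {n s : ℕ} (bk : Fin n → Fin s) (j : Fin s) :
    Matrix (Fin n) (Fin n) ℂ :=
  Matrix.diagonal fun i => if bk i = j then (1 : ℂ) else 0

/-- The matrix `ω j` defined from `A` and `λ` by the standard off-block formula. -/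
noncomputable def omM {n s : ℕ} (bk : Fin n → Fin s) (lam : Fin s → ℂ)
    (A : Matrix (Fin n) (Fin n) ℂ) (j : Fin s) : Matrix (Fin n) (Fin n) ℂ :=
  Matrix.of fun i k =>
    if bk i = bk k then 0
    else ((if bk i = j then (1 : ℂ) else 0) - (if bk k = j then (1 : ℂ) else 0)) * A i k
        / (lam (bk i) - lam (bk k))

theorem commutator_LamM_eq_iff {n s : ℕ} (bk : Fin n → Fin s) (lam : Fin s → ℂ)
    (hlam : ∀ a b : Fin s, a ≠ b → lam a ≠ lam b) (j : Fin s)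
    (ω A : Matrix (Fin n) (Fin n) ℂ) :
    LamM bk lam * ω - ω * LamM bk lam = EM bk j * A - A * EM bk j ↔
      ∀ i k : Fin n, bk i ≠ bk k →
        ω i k = ((if bk i = j then (1 : ℂ) else 0) - (if bk k = j then (1 : ℂ) else 0)) * A i k
          / (lam (bk i) - lam (bk k)) := by
  rw [← Matrix.ext_iff]
  refine forall₂_congr fun i k => ?_
  simp only [LamM, EM, Matrix.sub_apply, Matrix.diagonal_mul, Matrix.mul_diagonal]
  by_cases h : bk i = bk k
  · simp [h, mul_comm]
  · rw [forall_prop_of_true h, eq_div_iff (sub_ne_zero.2 (hlam _ _ h)), mul_comm (ω i k),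
      mul_comm (ω i k), mul_comm (A i k), sub_mul, sub_mul]

theorem statement0 {n s : ℕ} (hn : 0 < n) (hs : 0 < s) (bk : Fin n → Fin s)
    (lam : Fin s → ℂ) (hlam : ∀ a b : Fin s, a ≠ b → lam a ≠ lam b)
    (j : Fin s) (ω A : Matrix (Fin n) (Fin n) ℂ) :
    ((LamM bk lam * ω - ω * LamM bk lam = EM bk j * A - A * EM bk j) ↔
      (∀ i k : Fin n, bk i ≠ bk k →
        ω i k = ((if bk i = j then (1 : ℂ) else 0) - (if bk k = j then (1 : ℂ) else 0)) * A i k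
          / (lam (bk i) - lam (bk k))))
    ∧
    ((LamM bk lam * ω - ω * LamM bk lam = EM bk j * A - A * EM bk j) ↔
      (∃ D : Matrix (Fin n) (Fin n) ℂ,
        (∀ i k : Fin n, bk i ≠ bk k → D i k = 0) ∧ ω = omM bk lam A j + D)) := by
  have key := commutator_LamM_eq_iff bk lam hlam j ω A
  refine ⟨key, key.trans ⟨fun h => ⟨ω - omM bk lam A j, fun i k hik => ?_, by abel⟩, ?_⟩⟩
  · simp [omM, hik, h i k hik]
  · rintro ⟨D, hD, rfl⟩ i k hik
    simp [omM, hik, hD i k hik]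
end

section
/- Let A be any n×n complex matrix, λ : Fin s → ℂ with pairwise distinct values, and for each j : Fin s let ω j be the matrix defined from A and λ by the standard off-block formula. Then for all j, k : Fin s one has [E j, ω k] = [E k, ω j], i.e. (E j)(ω k) − (ω k)(E j) = (E k)(ω j) − (ω j)(E k). -/
open Matrix

theorem statement1 {n s : ℕ} (hn : 0 < n) (hs : 0 < s) (bk : Fin n → Fin s)
    (lam : Fin s → ℂ) (hlam : ∀ a b : Fin s, a ≠ b → lam a ≠ lam b)
    (A : Matrix (Fin n) (Fin n) ℂ) (j k : Fin s) :
    EM bk j * omM bk lam A k - omM bk lam A k * EM bk j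
      = EM bk k * omM bk lam A j - omM bk lam A j * EM bk k := by
  ext a b
  simp only [EM, omM, Matrix.sub_apply, Matrix.diagonal_mul, Matrix.mul_diagonal, Matrix.of_apply]
  by_cases h : bk a = bk b
  · simp only [if_pos h, mul_zero, zero_mul]
  · simp only [if_neg h]
    ring
end

section
/- Let A be any n×n complex matrix, λ : Fin s → ℂ with pairwise distinct values, and ω i, ω j the matrices defined from A and λ by the standard off-block formula. Then the block-diagonal part of the commutator [ω i, ω j] vanishes: for all indices p, q with π(p) = π(q), the (p,q) entry of (ω i)(ω j) − (ω j)(ω i) equals 0. -/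
open Matrix

theorem statement2 {n s : ℕ} (hn : 0 < n) (hs : 0 < s) (bk : Fin n → Fin s)
    (lam : Fin s → ℂ) (hlam : ∀ a b : Fin s, a ≠ b → lam a ≠ lam b)
    (A : Matrix (Fin n) (Fin n) ℂ) (i j : Fin s) :
    ∀ p q : Fin n, bk p = bk q →
      (omM bk lam A i * omM bk lam A j - omM bk lam A j * omM bk lam A i) p q = 0 := by
  intro p q hpq
  rw [Matrix.sub_apply, Matrix.mul_apply, Matrix.mul_apply, sub_eq_zero]
  refine Finset.sum_congr rfl fun r _ => ?_
  simp only [omM, Matrix.of_apply, hpq]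
  by_cases h : bk q = bk r
  · simp [h]
  · rw [if_neg h, if_neg h, if_neg (Ne.symm h), if_neg (Ne.symm h)]
    ring
end

section
/- Let U be an open subset of Fin s → ℂ on which the coordinates are pairwise distinct (λ(a) ≠ λ(b) for a ≠ b). Let A : U → M_n(ℂ) and 𝒟_j : U → M_n(ℂ) (j : Fin s) be holomorphic, with each 𝒟_j(λ) block-diagonal (its (i,k) entry is 0 whenever π(i) ≠ π(k)), let ω_j(λ) be defined from A(λ) and λ by the standard off-block formula, and set ω̃_j = ω_j + 𝒟_j. Then for all i, j : Fin s and all λ ∈ U: (1) the block-diagonal part of ∂_i ω̃_j − ∂_j ω̃_i − [ω̃_i, ω̃_j] equals ∂_i 𝒟_j − ∂_j 𝒟_i − [𝒟_i, 𝒟_j]; (2) the block-off-diagonal part of ∂_i ω̃_j − ∂_j ω̃_i − [ω̃_i, ω̃_j] equals ∂_i ω_j − ∂_j ω_i − [ω_i, ω_j] − [ω_i, 𝒟_j] − [𝒟_i, ω_j]. Consequently the zero-curvature system ∂_i ω̃_j − ∂_j ω̃_i = [ω̃_i, ω̃_j] (for all i,j) is equivalent to the conjunction of ∂_i 𝒟_j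 − ∂_j 𝒟_i = [𝒟_i, 𝒟_j] and ∂_i ω_j − ∂_j ω_i = [ω_i, ω_j] + [ω_i, 𝒟_j] + [𝒟_i, ω_j] (for all i,j). -/
open Matrix

/-- `ω_j` as a matrix-valued function of the deformation parameter `λ`. -/
noncomputable def omF {n s : ℕ} (bk : Fin n → Fin s)
    (A : (Fin s → ℂ) → Matrix (Fin n) (Fin n) ℂ) (j : Fin s)
    (x : Fin s → ℂ) : Matrix (Fin n) (Fin n) ℂ :=
  omM bk x (A x) j

/-- `ω̃_j = ω_j + 𝒟_j` as a matrix-valued function of `λ`. -/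
noncomputable def tomF {n s : ℕ} (bk : Fin n → Fin s)
    (A : (Fin s → ℂ) → Matrix (Fin n) (Fin n) ℂ)
    (DD : Fin s → (Fin s → ℂ) → Matrix (Fin n) (Fin n) ℂ) (j : Fin s)
    (x : Fin s → ℂ) : Matrix (Fin n) (Fin n) ℂ :=
  omF bk A j x + DD j x

/-- Entrywise partial derivative `∂_j F` of a matrix-valued function on `ℂ^s`. -/
noncomputable def pd {n s : ℕ} (F : (Fin s → ℂ) → Matrix (Fin n) (Fin n) ℂ)
    (j : Fin s) (x : Fin s → ℂ) : Matrix (Fin n) (Fin n) ℂ :=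
  Matrix.of fun p q => fderiv ℂ (fun y => F y p q) x (Pi.single j 1)

/-- The block-diagonal part of a matrix: keep the entries with `π(i) = π(k)`. -/
def BD {n s : ℕ} (bk : Fin n → Fin s) (M : Matrix (Fin n) (Fin n) ℂ) :
    Matrix (Fin n) (Fin n) ℂ :=
  Matrix.of fun i k => if bk i = bk k then M i k else 0

/-- The block-off-diagonal part of a matrix: keep the entries with `π(i) ≠ π(k)`. -/
def BOD {n s : ℕ} (bk : Fin n → Fin s) (M : Matrix (Fin n) (Fin n) ℂ) :
    Matrix (Fin n) (Fin n) ℂ :=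
  Matrix.of fun i k => if bk i = bk k then 0 else M i k

/-- A matrix whose entries vanish off the diagonal blocks. -/
def IsBlockDiag {n s : ℕ} (bk : Fin n → Fin s) (M : Matrix (Fin n) (Fin n) ℂ) : Prop :=
  ∀ p q, bk p ≠ bk q → M p q = 0

/-- A matrix whose entries vanish on the diagonal blocks. -/
def IsBlockOffDiag {n s : ℕ} (bk : Fin n → Fin s) (M : Matrix (Fin n) (Fin n) ℂ) : Prop :=
  ∀ p q, bk p = bk q → M p q = 0

section BlockMatrices

variable {n s : ℕ} {bk : Fin n → Fin s} {M N : Matrix (Fin n) (Fin n) ℂ}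

lemma IsBlockDiag.sub (hM : IsBlockDiag bk M) (hN : IsBlockDiag bk N) :
    IsBlockDiag bk (M - N) := fun p q h => by
  rw [Matrix.sub_apply, hM p q h, hN p q h, sub_zero]

lemma IsBlockOffDiag.sub (hM : IsBlockOffDiag bk M) (hN : IsBlockOffDiag bk N) :
    IsBlockOffDiag bk (M - N) := fun p q h => by
  rw [Matrix.sub_apply, hM p q h, hN p q h, sub_zero]

lemma IsBlockDiag.mul (hM : IsBlockDiag bk M) (hN : IsBlockDiag bk N) :
    IsBlockDiag bk (M * N) := fun p q h => by
  rw [Matrix.mul_apply]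
  refine Finset.sum_eq_zero fun r _ => ?_
  by_cases hr : bk p = bk r
  · rw [hN r q (hr ▸ h), mul_zero]
  · rw [hM p r hr, zero_mul]

lemma IsBlockDiag.mul_offDiag (hM : IsBlockDiag bk M) (hN : IsBlockOffDiag bk N) :
    IsBlockOffDiag bk (M * N) := fun p q h => by
  rw [Matrix.mul_apply]
  refine Finset.sum_eq_zero fun r _ => ?_
  by_cases hr : bk p = bk r
  · rw [hN r q (hr.symm.trans h), mul_zero]
  · rw [hM p r hr, zero_mul]

lemma IsBlockOffDiag.mul_diag (hM : IsBlockOffDiag bk M) (hN : IsBlockDiag bk N) :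
    IsBlockOffDiag bk (M * N) := fun p q h => by
  rw [Matrix.mul_apply]
  refine Finset.sum_eq_zero fun r _ => ?_
  by_cases hr : bk p = bk r
  · rw [hM p r hr, zero_mul]
  · rw [hN r q (fun hrq => hr (h.trans hrq.symm)), mul_zero]

lemma BD_add_eq_left (hM : IsBlockDiag bk M) (hN : IsBlockOffDiag bk N) :
    BD bk (M + N) = M := by
  ext p q
  by_cases h : bk p = bk q
  · simp [BD, h, hN p q h]
  · simp [BD, h, hM p q h]

lemma BOD_add_eq_right (hM : IsBlockDiag bk M) (hN : IsBlockOffDiag bk N) :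
    BOD bk (M + N) = N := by
  ext p q
  by_cases h : bk p = bk q
  · simp [BOD, h, hN p q h]
  · simp [BOD, h, hM p q h]

lemma add_eq_zero_iff_of_blocks (hM : IsBlockDiag bk M) (hN : IsBlockOffDiag bk N) :
    M + N = 0 ↔ M = 0 ∧ N = 0 := by
  refine ⟨fun h => ⟨?_, ?_⟩, fun ⟨h₁, h₂⟩ => by rw [h₁, h₂, add_zero]⟩
  · rw [← BD_add_eq_left hM hN, h]
    ext
    simp [BD]
  · rw [← BOD_add_eq_right hM hN, h]
    ext
    simp [BOD]

lemma isBlockOffDiag_omM (lam : Fin s → ℂ) (A : Matrix (Fin n) (Fin n) ℂ) (j : Fin s) :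
    IsBlockOffDiag bk (omM bk lam A j) := fun p q h => by
  simp [omM, h]

/-- On the diagonal blocks, the product `ω_i ω_j` is symmetric in `i` and `j`. -/
lemma isBlockOffDiag_commutator_omM (lam : Fin s → ℂ) (A : Matrix (Fin n) (Fin n) ℂ)
    (i j : Fin s) :
    IsBlockOffDiag bk
      (omM bk lam A i * omM bk lam A j - omM bk lam A j * omM bk lam A i) := fun p q h => by
  rw [Matrix.sub_apply, Matrix.mul_apply, Matrix.mul_apply, ← Finset.sum_sub_distrib]
  refine Finset.sum_eq_zero fun r _ => ?_
  simp only [omM, Matrix.of_apply, ← h]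
  by_cases hr : bk p = bk r
  · simp [hr]
  · rw [if_neg hr, if_neg hr, if_neg (Ne.symm hr), if_neg (Ne.symm hr)]
    ring

end BlockMatrices

section PartialDerivatives

variable {n s : ℕ} {bk : Fin n → Fin s} {F G : (Fin s → ℂ) → Matrix (Fin n) (Fin n) ℂ}
  {x : Fin s → ℂ}

lemma pd_add (hF : ∀ p q, DifferentiableAt ℂ (fun y => F y p q) x)
    (hG : ∀ p q, DifferentiableAt ℂ (fun y => G y p q) x) (j : Fin s) :
    pd (fun y => F y + G y) j x = pd F j x + pd G j x := by
  ext p q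
  simp only [pd, Matrix.of_apply, Matrix.add_apply]
  rw [fderiv_fun_add (hF p q) (hG p q)]
  rfl

lemma pd_apply_eq_zero {p q : Fin n} (h : ∀ᶠ y in nhds x, F y p q = 0) (j : Fin s) :
    pd F j x p q = 0 := by
  have h' : (fun y => F y p q) =ᶠ[nhds x] fun _ => 0 := h
  simp [pd, h'.fderiv_eq]

lemma isBlockOffDiag_pd_omF (A : (Fin s → ℂ) → Matrix (Fin n) (Fin n) ℂ) (i j : Fin s) :
    IsBlockOffDiag bk (pd (omF bk A j) i x) := fun p q h =>
  pd_apply_eq_zero (.of_forall fun y => isBlockOffDiag_omM y (A y) j p q h) i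

lemma differentiableAt_omF {A : (Fin s → ℂ) → Matrix (Fin n) (Fin n) ℂ}
    (hx : ∀ a b, a ≠ b → x a ≠ x b) (hA : ∀ p q, DifferentiableAt ℂ (fun y => A y p q) x)
    (j : Fin s) (p q : Fin n) : DifferentiableAt ℂ (fun y => omF bk A j y p q) x := by
  simp only [omF, omM, Matrix.of_apply]
  by_cases h : bk p = bk q
  · simp [h]
  · simp only [if_neg h]
    have hne : x (bk p) - x (bk q) ≠ 0 := sub_ne_zero.2 (hx _ _ h)
    have hApq := hA p q
    fun_prop (disch := exact hne)

end PartialDerivatives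

theorem statement4 {n s : ℕ} (hn : 0 < n) (hs : 0 < s) (bk : Fin n → Fin s)
    (U : Set (Fin s → ℂ)) (hU : IsOpen U)
    (hdist : ∀ x ∈ U, ∀ a b : Fin s, a ≠ b → x a ≠ x b)
    (A : (Fin s → ℂ) → Matrix (Fin n) (Fin n) ℂ)
    (hA : ∀ p q : Fin n, DifferentiableOn ℂ (fun y => A y p q) U)
    (DD : Fin s → (Fin s → ℂ) → Matrix (Fin n) (Fin n) ℂ)
    (hDdiff : ∀ (j : Fin s) (p q : Fin n), DifferentiableOn ℂ (fun y => DD j y p q) U)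
    (hDbd : ∀ j : Fin s, ∀ x ∈ U, ∀ p q : Fin n, bk p ≠ bk q → DD j x p q = 0) :
    -- (1) the block-diagonal part of the curvature of ω̃ equals the curvature of 𝒟
    (∀ i j : Fin s, ∀ x ∈ U,
      BD bk (pd (tomF bk A DD j) i x - pd (tomF bk A DD i) j x
          - (tomF bk A DD i x * tomF bk A DD j x - tomF bk A DD j x * tomF bk A DD i x))
        = pd (DD j) i x - pd (DD i) j x - (DD i x * DD j x - DD j x * DD i x))
    ∧
    -- (2) the block-off-diagonal part of the curvature of ω̃
    (∀ i j : Fin s, ∀ x ∈ U,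
      BOD bk (pd (tomF bk A DD j) i x - pd (tomF bk A DD i) j x
          - (tomF bk A DD i x * tomF bk A DD j x - tomF bk A DD j x * tomF bk A DD i x))
        = pd (omF bk A j) i x - pd (omF bk A i) j x
          - (omF bk A i x * omF bk A j x - omF bk A j x * omF bk A i x)
          - (omF bk A i x * DD j x - DD j x * omF bk A i x)
          - (DD i x * omF bk A j x - omF bk A j x * DD i x))
    ∧
    -- Consequently: zero curvature of ω̃ on U is equivalent to the conjunction
    ((∀ i j : Fin s, ∀ x ∈ U,
        pd (tomF bk A DD j) i x - pd (tomF bk A DD i) j x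
          = tomF bk A DD i x * tomF bk A DD j x - tomF bk A DD j x * tomF bk A DD i x)
      ↔
      ((∀ i j : Fin s, ∀ x ∈ U,
          pd (DD j) i x - pd (DD i) j x = DD i x * DD j x - DD j x * DD i x)
        ∧
        (∀ i j : Fin s, ∀ x ∈ U,
          pd (omF bk A j) i x - pd (omF bk A i) j x
            = (omF bk A i x * omF bk A j x - omF bk A j x * omF bk A i x)
              + (omF bk A i x * DD j x - DD j x * omF bk A i x)
              + (DD i x * omF bk A j x - omF bk A j x * DD i x)))) := by
  have hDpd : ∀ i j, ∀ x ∈ U, IsBlockDiag bk (pd (DD j) i x) := fun i j x hx p q h =>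
    pd_apply_eq_zero
      (Filter.eventually_of_mem (hU.mem_nhds hx) fun y hy => hDbd j y hy p q h) i
  have hpd : ∀ i j, ∀ x ∈ U,
      pd (tomF bk A DD j) i x = pd (omF bk A j) i x + pd (DD j) i x := fun i j x hx =>
    pd_add (differentiableAt_omF (hdist x hx)
        (fun p q => (hA p q).differentiableAt (hU.mem_nhds hx)) j)
      (fun p q => (hDdiff j p q).differentiableAt (hU.mem_nhds hx)) i
  have hdiag : ∀ i j, ∀ x ∈ U, IsBlockDiag bk
      (pd (DD j) i x - pd (DD i) j x - (DD i x * DD j x - DD j x * DD i x)) :=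
    fun i j x hx => ((hDpd i j x hx).sub (hDpd j i x hx)).sub
      ((IsBlockDiag.mul (hDbd i x hx) (hDbd j x hx)).sub
        (IsBlockDiag.mul (hDbd j x hx) (hDbd i x hx)))
  have hoff : ∀ i j, ∀ x ∈ U, IsBlockOffDiag bk
      (pd (omF bk A j) i x - pd (omF bk A i) j x
        - (omF bk A i x * omF bk A j x - omF bk A j x * omF bk A i x)
        - (omF bk A i x * DD j x - DD j x * omF bk A i x)
        - (DD i x * omF bk A j x - omF bk A j x * DD i x)) := fun i j x hx => by
    have hom : ∀ k, IsBlockOffDiag bk (omF bk A k x) := isBlockOffDiag_omM x (A x)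
    have hD : ∀ k, IsBlockDiag bk (DD k x) := fun k => hDbd k x hx
    exact ((((isBlockOffDiag_pd_omF A i j).sub (isBlockOffDiag_pd_omF A j i)).sub
      (isBlockOffDiag_commutator_omM x (A x) i j)).sub
      (((hom i).mul_diag (hD j)).sub ((hD j).mul_offDiag (hom i)))).sub
      (((hD i).mul_offDiag (hom j)).sub ((hom j).mul_diag (hD i)))
  have hsplit : ∀ i j, ∀ x ∈ U,
      pd (tomF bk A DD j) i x - pd (tomF bk A DD i) j x
          - (tomF bk A DD i x * tomF bk A DD j x - tomF bk A DD j x * tomF bk A DD i x)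
        = (pd (DD j) i x - pd (DD i) j x - (DD i x * DD j x - DD j x * DD i x))
          + (pd (omF bk A j) i x - pd (omF bk A i) j x
            - (omF bk A i x * omF bk A j x - omF bk A j x * omF bk A i x)
            - (omF bk A i x * DD j x - DD j x * omF bk A i x)
            - (DD i x * omF bk A j x - omF bk A j x * DD i x)) := fun i j x hx => by
    rw [hpd i j x hx, hpd j i x hx]
    simp only [tomF]
    noncomm_ring
  have hiff : ∀ i j, ∀ x ∈ U,
      (pd (tomF bk A DD j) i x - pd (tomF bk A DD i) j x
          = tomF bk A DD i x * tomF bk A DD j x - tomF bk A DD j x * tomF bk A DD i x) ↔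
      (pd (DD j) i x - pd (DD i) j x = DD i x * DD j x - DD j x * DD i x ∧
        pd (omF bk A j) i x - pd (omF bk A i) j x
          = (omF bk A i x * omF bk A j x - omF bk A j x * omF bk A i x)
            + (omF bk A i x * DD j x - DD j x * omF bk A i x)
            + (DD i x * omF bk A j x - omF bk A j x * DD i x)) := fun i j x hx => by
    rw [← sub_eq_zero, hsplit i j x hx,
      add_eq_zero_iff_of_blocks (hdiag i j x hx) (hoff i j x hx), sub_eq_zero,
      sub_sub _ _ (omF bk A i x * DD j x - _), sub_sub, sub_eq_zero, add_assoc]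
  refine ⟨fun i j x hx => ?_, fun i j x hx => ?_, ?_⟩
  · rw [hsplit i j x hx, BD_add_eq_left (hdiag i j x hx) (hoff i j x hx)]
  · rw [hsplit i j x hx, BOD_add_eq_right (hdiag i j x hx) (hoff i j x hx)]
  · exact ⟨fun h => ⟨fun i j x hx => ((hiff i j x hx).1 (h i j x hx)).1,
        fun i j x hx => ((hiff i j x hx).1 (h i j x hx)).2⟩,
      fun h i j x hx => (hiff i j x hx).2 ⟨h.1 i j x hx, h.2 i j x hx⟩⟩
end

section
/- Let U be an open subset of Fin s → ℂ on which the coordinates are pairwise distinct. Let A : U → M_n(ℂ) and 𝒟_j : U → M_n(ℂ) (j : Fin s) be holomorphic, with each 𝒟_j(λ) block-diagonal, let ω_j(λ) be defined from A(λ) and λ by the standard off-block formula, and set ω̃_j = ω_j + 𝒟_j. Assume ∂_j A = [ω̃_j, A] on U for every j : Fin s. Then the block-diagonal part A^D of A satisfies ∂_j (A^D) = [𝒟_j, A^D] on U for every j. In particular, if 𝒟_j = 0 for all j and U is connected, then A^D is constant on U. -/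
open Matrix

/-- The commutator of `ω j` with `A` has no block-diagonal part. -/
lemma omM_commutator_apply_of_eq {n s : ℕ} (bk : Fin n → Fin s) (lam : Fin s → ℂ)
    (A : Matrix (Fin n) (Fin n) ℂ) (j : Fin s) {p q : Fin n} (h : bk p = bk q) :
    (omM bk lam A j * A - A * omM bk lam A j) p q = 0 := by
  rw [Matrix.sub_apply, sub_eq_zero, Matrix.mul_apply, Matrix.mul_apply]
  refine Finset.sum_congr rfl fun l _ => ?_
  simp only [omM, Matrix.of_apply, ← h, eq_comm (a := bk l) (b := bk p)]
  by_cases hl : bk p = bk l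
  · simp [hl]
  · rw [if_neg hl, if_neg hl, ← neg_sub (lam (bk p)) (lam (bk l)), div_neg]
    ring

/-- On diagonal blocks, the commutator of a block-diagonal matrix with `A` only sees the
block-diagonal part of `A`; off the diagonal blocks, its commutator with `BD bk A` vanishes. -/
lemma commutator_BD {n s : ℕ} (bk : Fin n → Fin s) (A D : Matrix (Fin n) (Fin n) ℂ)
    (hD : ∀ p q : Fin n, bk p ≠ bk q → D p q = 0) :
    D * BD bk A - BD bk A * D = BD bk (D * A - A * D) := by
  ext p q
  simp only [BD, Matrix.of_apply, Matrix.sub_apply, Matrix.mul_apply, ← Finset.sum_sub_distrib]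
  split_ifs with h
  · refine Finset.sum_congr rfl fun l _ => ?_
    by_cases hl : bk p = bk l
    · rw [if_pos (hl.symm.trans h), if_pos hl]
    · rw [hD p l hl, hD l q (fun e => hl (h.trans e.symm)), if_neg hl]; simp
  · refine Finset.sum_eq_zero fun l _ => ?_
    by_cases hl : bk p = bk l
    · rw [if_neg (fun e => h (hl.trans e)), hD l q (fun e => h (hl.trans e))]; simp
    · rw [hD p l hl, if_neg hl]; simp

/-- Taking the block-diagonal part commutes with partial derivatives. -/
lemma pd_BD {n s : ℕ} (bk : Fin n → Fin s) (A : (Fin s → ℂ) → Matrix (Fin n) (Fin n) ℂ)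
    (j : Fin s) (x : Fin s → ℂ) :
    pd (fun y => BD bk (A y)) j x = BD bk (pd A j x) := by
  ext p q
  by_cases h : bk p = bk q <;> simp [pd, BD, h]

/-- On a connected open set, a holomorphic matrix function whose partial derivatives all vanish
is constant. -/
lemma eq_of_pd_eq_zero {n s : ℕ} {U : Set (Fin s → ℂ)} (hU : IsOpen U) (hc : IsPreconnected U)
    {F : (Fin s → ℂ) → Matrix (Fin n) (Fin n) ℂ}
    (hF : ∀ p q : Fin n, DifferentiableOn ℂ (fun y => F y p q) U)
    (h : ∀ j : Fin s, ∀ x ∈ U, pd F j x = 0) {x y : Fin s → ℂ} (hx : x ∈ U) (hy : y ∈ U) :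
    F x = F y := by
  ext p q
  refine hU.is_const_of_fderiv_eq_zero hc (hF p q) (fun z hz => ?_) hx hy
  refine ContinuousLinearMap.coe_injective (LinearMap.pi_ext' fun j => LinearMap.ext_ring ?_)
  simpa [pd] using congrFun (congrFun (h j z hz) p) q

theorem statement6 {n s : ℕ} (hn : 0 < n) (hs : 0 < s) (bk : Fin n → Fin s)
    (U : Set (Fin s → ℂ)) (hU : IsOpen U)
    (hdist : ∀ x ∈ U, ∀ a b : Fin s, a ≠ b → x a ≠ x b)
    (A : (Fin s → ℂ) → Matrix (Fin n) (Fin n) ℂ)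
    (hA : ∀ p q : Fin n, DifferentiableOn ℂ (fun y => A y p q) U)
    (DD : Fin s → (Fin s → ℂ) → Matrix (Fin n) (Fin n) ℂ)
    (hDdiff : ∀ (j : Fin s) (p q : Fin n), DifferentiableOn ℂ (fun y => DD j y p q) U)
    (hDbd : ∀ j : Fin s, ∀ x ∈ U, ∀ p q : Fin n, bk p ≠ bk q → DD j x p q = 0)
    -- the deformation equations ∂_j A = [ω̃_j, A] on U, with ω̃_j = ω_j + 𝒟_j
    (hdef : ∀ j : Fin s, ∀ x ∈ U,
      pd A j x = (omF bk A j x + DD j x) * A x - A x * (omF bk A j x + DD j x)) :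
    -- ∂_j (A^D) = [𝒟_j, A^D] on U
    (∀ j : Fin s, ∀ x ∈ U,
      pd (fun y => BD bk (A y)) j x = DD j x * BD bk (A x) - BD bk (A x) * DD j x)
    ∧
    -- in particular, if 𝒟 = 0 and U is connected, then A^D is constant on U
    ((∀ j : Fin s, ∀ x ∈ U, DD j x = 0) → IsConnected U →
      ∀ x ∈ U, ∀ y ∈ U, BD bk (A x) = BD bk (A y)) := by
  have key : ∀ j : Fin s, ∀ x ∈ U,
      pd (fun y => BD bk (A y)) j x = DD j x * BD bk (A x) - BD bk (A x) * DD j x := by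
    intro j x hx
    rw [pd_BD, hdef j x hx, commutator_BD bk _ _ (hDbd j x hx)]
    ext p q
    simp only [BD, Matrix.of_apply]
    split_ifs with h
    · have h0 := omM_commutator_apply_of_eq bk x (A x) j h
      rw [add_mul, mul_add, add_sub_add_comm, Matrix.add_apply, omF, h0, zero_add]
    · rfl
  refine ⟨key, fun hD hc x hx y hy => ?_⟩
  refine eq_of_pd_eq_zero (F := fun y => BD bk (A y)) hU hc.isPreconnected (fun p q => ?_)
    (fun j z hz => ?_) hx hy
  · by_cases h : bk p = bk q
    · simpa [BD, h] using hA p q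
    · simp [BD, h]
  · rw [key j z hz, hD j z hz, zero_mul, mul_zero, sub_zero]
end

section
/- Let Δ, M, N be n×n complex matrices with Δ diagonal. Define N^Δ to be the matrix with (N^Δ)_{ik} = N_{ik} if Δ_{ii} = Δ_{kk} and (N^Δ)_{ik} = 0 otherwise. If M commutes with Δ and M commutes with N, then M commutes with N^Δ; in particular [M, Δ + N^Δ] = 0. (This is the key algebraic step proving that T⁻¹dT commutes with the Jordan form J in the Appendix: from [T⁻¹dT, D+Σ] = 0 and [T⁻¹dT, N] = 0 one deduces [T⁻¹dT, J] = 0.) -/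
open Matrix

open scoped Classical in
/-- `N^Δ`: the matrix with `(N^Δ)_{ik} = N_{ik}` if `Δ_{ii} = Δ_{kk}` and `0` otherwise. -/
noncomputable def NDel {n : ℕ} (Δ N : Matrix (Fin n) (Fin n) ℂ) :
    Matrix (Fin n) (Fin n) ℂ :=
  Matrix.of fun i k => if Δ i i = Δ k k then N i k else 0

/-- A matrix commuting with a diagonal matrix `Δ` has no entries linking distinct diagonal
values of `Δ`. -/
theorem diag_eq_of_commute_of_ne_zero {n : ℕ} {Δ M : Matrix (Fin n) (Fin n) ℂ}
    (hΔ : ∀ i k : Fin n, i ≠ k → Δ i k = 0) (hMΔ : M * Δ = Δ * M) {i k : Fin n}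
    (h : M i k ≠ 0) : Δ i i = Δ k k := by
  have hd : Δ = diagonal fun i => Δ i i := by
    ext a b
    by_cases hab : a = b
    · subst hab
      simp
    · simp [hab, hΔ a b hab]
  have he := congrFun (congrFun hMΔ i) k
  rw [hd, mul_diagonal, diagonal_mul, mul_comm] at he
  exact (mul_right_cancel₀ h he).symm

/-- A matrix commuting with a diagonal matrix `Δ` and with `N` commutes with `NDel Δ N`. -/
theorem mul_NDel_comm {n : ℕ} {Δ M N : Matrix (Fin n) (Fin n) ℂ}
    (hΔ : ∀ i k : Fin n, i ≠ k → Δ i k = 0)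
    (hMΔ : M * Δ = Δ * M) (hMN : M * N = N * M) :
    M * NDel Δ N = NDel Δ N * M := by
  ext i k
  have hl : (M * NDel Δ N) i k = if Δ i i = Δ k k then (M * N) i k else 0 := by
    have hj (j) : M i j * NDel Δ N j k = if Δ i i = Δ k k then M i j * N j k else 0 := by
      by_cases h : M i j = 0
      · simp [h]
      · simp [NDel, diag_eq_of_commute_of_ne_zero hΔ hMΔ h]
    simp only [mul_apply, hj]
    split_ifs <;> simp
  have hr : (NDel Δ N * M) i k = if Δ i i = Δ k k then (N * M) i k else 0 := by
    have hj (j) : NDel Δ N i j * M j k = if Δ i i = Δ k k then N i j * M j k else 0 := by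
      by_cases h : M j k = 0
      · simp [h]
      · simp [NDel, diag_eq_of_commute_of_ne_zero hΔ hMΔ h]
    simp only [mul_apply, hj]
    split_ifs <;> simp
  rw [hl, hr, hMN]

theorem statement11 {n : ℕ} (Δ M N : Matrix (Fin n) (Fin n) ℂ)
    (hΔ : ∀ i k : Fin n, i ≠ k → Δ i k = 0)
    (hMΔ : M * Δ = Δ * M) (hMN : M * N = N * M) :
    M * NDel Δ N = NDel Δ N * M ∧
      M * (Δ + NDel Δ N) - (Δ + NDel Δ N) * M = 0 := by
  have h := mul_NDel_comm hΔ hMΔ hMN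
  exact ⟨h, by rw [mul_add, add_mul, hMΔ, h, sub_self]⟩
end

section
/- Let A12, A13, A21, A23, A31, A32 ∈ ℂ with A23·A32 ≠ 0, and let ρ ∈ ℂ satisfy ρ² = A23·A32 (so ρ ≠ 0). Let A be the 3×3 matrix [[0,A12,A13],[A21,0,A23],[A31,A32,0]], T₀ = [[1,0,0],[0, A23/ρ, −A23/ρ],[0,1,1]], and for x in the slit plane Ω = ℂ ∖ (−∞,0], let ω₁(x) = (1/x)·[[0,A12,A13],[A21,0,0],[A31,0,0]]. Let b₀, c₀ ∈ ℂ∖{0}, let a : Ω → ℂ be differentiable and nonvanishing, and set T(x) = T₀ · diag(a(x), b₀·x^ρ·a(x), c₀·x^{−ρ}·a(x)) with principal complex powers. Then for every x ∈ Ω, T is differentiable at x, T(x) is invertible, and T′(x)·T(x)⁻¹ = (a′(x)/a(x))·I₃ + (1/x)·[[0,0,0],[0,0,A23],[0,A32,0]]; consequently ω₁(x) + T′(x)T(x)⁻¹ = (a′(x)/a(x))·I₃ + A/x, and in particular [ω₁(x) + T′(x)T(x)⁻¹, A] = 0. -/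
open Matrix Complex

/-- The constant matrix `T₀` diagonalizing the block-diagonal part of `A`. -/
noncomputable def T0 (A23 ρ : ℂ) : Matrix (Fin 3) (Fin 3) ℂ :=
  !![1, 0, 0; 0, A23 / ρ, -(A23 / ρ); 0, 1, 1]

/-- `T(x) = T₀ · diag(a(x), b₀·x^ρ·a(x), c₀·x^{−ρ}·a(x))` with principal powers. -/
noncomputable def Tm (A23 ρ b₀ c₀ : ℂ) (a : ℂ → ℂ) (x : ℂ) :
    Matrix (Fin 3) (Fin 3) ℂ :=
  T0 A23 ρ * Matrix.diagonal ![a x, b₀ * x ^ ρ * a x, c₀ * x ^ (-ρ) * a x]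

/-- `ω₁(x)`. -/
noncomputable def om1 (A12 A13 A21 A31 : ℂ) (x : ℂ) : Matrix (Fin 3) (Fin 3) ℂ :=
  x⁻¹ • !![0, A12, A13; A21, 0, 0; A31, 0, 0]

/-- The function `c · x^s · a(x)` has logarithmic derivative `a'/a + s/x`. -/
theorem hasDerivAt_const_mul_cpow_mul {a : ℂ → ℂ} {d x : ℂ} (c s : ℂ)
    (hx : x ∈ Complex.slitPlane) (ha : HasDerivAt a d x) (ha0 : a x ≠ 0) :
    HasDerivAt (fun t => c * t ^ s * a t) ((d / a x + s / x) * (c * x ^ s * a x)) x := by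
  have hx0 : x ≠ 0 := Complex.slitPlane_ne_zero hx
  have h := (((hasDerivAt_id x).cpow_const (c := s) hx).const_mul c).mul ha
  refine h.congr_deriv ?_
  simp only [id, Complex.cpow_sub _ _ hx0, Complex.cpow_one]
  field_simp
  ring

theorem det_Tm (A23 ρ b₀ c₀ : ℂ) (a : ℂ → ℂ) (x : ℂ) :
    (Tm A23 ρ b₀ c₀ a x).det
      = 2 * (A23 / ρ) * (a x * (b₀ * x ^ ρ * a x) * (c₀ * x ^ (-ρ) * a x)) := by
  rw [Tm, Matrix.det_mul, Matrix.det_diagonal, Fin.prod_univ_three]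
  congr 1
  simp [T0, Matrix.det_fin_three]
  ring

/-- `T` solves the linear system `T' = ((a'/a)·I + B/x)·T`, with `B` the lower right block. -/
theorem hasDerivAt_Tm {A23 A32 ρ : ℂ} (b₀ c₀ : ℂ) {a : ℂ → ℂ} {d x : ℂ}
    (hρ0 : ρ ≠ 0) (hρ : ρ ^ 2 = A23 * A32)
    (hx : x ∈ Complex.slitPlane) (ha : HasDerivAt a d x) (ha0 : a x ≠ 0) (p q : Fin 3) :
    HasDerivAt (fun t => Tm A23 ρ b₀ c₀ a t p q)
      ((((d / a x) • (1 : Matrix (Fin 3) (Fin 3) ℂ)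
        + x⁻¹ • !![0, 0, 0; 0, 0, A23; 0, A32, 0]) * Tm A23 ρ b₀ c₀ a x) p q) x := by
  have hx0 : x ≠ 0 := Complex.slitPlane_ne_zero hx
  have hA32 : A32 * (A23 / ρ) = ρ := by
    field_simp
    linear_combination -hρ
  have hA23 : A23 / ρ * ρ = A23 := div_mul_cancel₀ _ hρ0
  have hq : HasDerivAt
      (fun t => (![a t, b₀ * t ^ ρ * a t, c₀ * t ^ (-ρ) * a t] : Fin 3 → ℂ) q)
      ((d / a x + (![0, ρ, -ρ] : Fin 3 → ℂ) q / x)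
        * (![a x, b₀ * x ^ ρ * a x, c₀ * x ^ (-ρ) * a x] : Fin 3 → ℂ) q) x := by
    fin_cases q
    · simpa [ha0] using ha
    · exact hasDerivAt_const_mul_cpow_mul b₀ ρ hx ha ha0
    · exact hasDerivAt_const_mul_cpow_mul c₀ (-ρ) hx ha ha0
  have hB : (!![0, 0, 0; 0, 0, A23; 0, A32, 0] : Matrix (Fin 3) (Fin 3) ℂ) * T0 A23 ρ
      = T0 A23 ρ * Matrix.diagonal ![0, ρ, -ρ] := by
    ext i j
    fin_cases i <;> fin_cases j <;>
      simp [T0, Matrix.mul_apply, Fin.sum_univ_three, hA32, hA23]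
  simp only [Tm, add_mul, smul_mul_assoc, one_mul, ← mul_assoc, hB]
  simp only [Matrix.add_apply, Matrix.smul_apply, Matrix.mul_diagonal, smul_eq_mul]
  refine (hq.const_mul (T0 A23 ρ p q)).congr_deriv ?_
  ring

theorem statement12 (A12 A13 A21 A23 A31 A32 ρ b₀ c₀ : ℂ)
    (hA : A23 * A32 ≠ 0) (hρ : ρ ^ 2 = A23 * A32)
    (hb₀ : b₀ ≠ 0) (hc₀ : c₀ ≠ 0)
    (a a' : ℂ → ℂ)
    (ha : ∀ x ∈ Complex.slitPlane, HasDerivAt a (a' x) x)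
    (ha0 : ∀ x ∈ Complex.slitPlane, a x ≠ 0) :
    ∀ x ∈ Complex.slitPlane,
      ∃ T' : Matrix (Fin 3) (Fin 3) ℂ,
        -- T is differentiable at x, with (entrywise) derivative T'
        (∀ p q : Fin 3, HasDerivAt (fun t => Tm A23 ρ b₀ c₀ a t p q) (T' p q) x) ∧
        -- T(x) is invertible
        IsUnit (Tm A23 ρ b₀ c₀ a x).det ∧
        -- T′(x)·T(x)⁻¹ = (a′/a)·I + (1/x)·[[0,0,0],[0,0,A23],[0,A32,0]]
        T' * (Tm A23 ρ b₀ c₀ a x)⁻¹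
          = (a' x / a x) • (1 : Matrix (Fin 3) (Fin 3) ℂ)
            + x⁻¹ • !![0, 0, 0; 0, 0, A23; 0, A32, 0] ∧
        -- consequently ω₁(x) + T′(x)T(x)⁻¹ = (a′/a)·I + A/x
        om1 A12 A13 A21 A31 x + T' * (Tm A23 ρ b₀ c₀ a x)⁻¹
          = (a' x / a x) • (1 : Matrix (Fin 3) (Fin 3) ℂ)
            + x⁻¹ • !![0, A12, A13; A21, 0, A23; A31, A32, 0] ∧
        -- and in particular [ω₁(x) + T′(x)T(x)⁻¹, A] = 0
        (om1 A12 A13 A21 A31 x + T' * (Tm A23 ρ b₀ c₀ a x)⁻¹)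
            * !![0, A12, A13; A21, 0, A23; A31, A32, 0]
          - !![0, A12, A13; A21, 0, A23; A31, A32, 0]
            * (om1 A12 A13 A21 A31 x + T' * (Tm A23 ρ b₀ c₀ a x)⁻¹) = 0 := by
  intro x hx
  have hρ0 : ρ ≠ 0 := by
    rintro rfl
    exact hA (by simpa using hρ.symm)
  have hA23 : A23 ≠ 0 := left_ne_zero_of_mul hA
  have hx0 : x ≠ 0 := Complex.slitPlane_ne_zero hx
  have hdet : IsUnit (Tm A23 ρ b₀ c₀ a x).det := by
    rw [det_Tm, isUnit_iff_ne_zero]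
    simp [hA23, hρ0, hb₀, hc₀, ha0 x hx, hx0, Complex.cpow_eq_zero_iff]
  have hsum : om1 A12 A13 A21 A31 x + ((a' x / a x) • (1 : Matrix (Fin 3) (Fin 3) ℂ)
        + x⁻¹ • !![0, 0, 0; 0, 0, A23; 0, A32, 0])
      = (a' x / a x) • (1 : Matrix (Fin 3) (Fin 3) ℂ)
        + x⁻¹ • !![0, A12, A13; A21, 0, A23; A31, A32, 0] := by
    rw [om1, add_left_comm, ← smul_add]
    simp
  refine ⟨_, hasDerivAt_Tm b₀ c₀ hρ0 hρ hx (ha x hx) (ha0 x hx), hdet, ?_⟩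
  rw [Matrix.mul_nonsing_inv_cancel_right _ _ hdet, hsum]
  refine ⟨rfl, rfl, ?_⟩
  simp only [add_mul, mul_add, smul_mul_assoc, mul_smul_comm, one_mul, mul_one, sub_self]
end

section
/- Let U be an open subset of Fin s → ℂ on which the coordinates are pairwise distinct, let A : U → M_n(ℂ) be differentiable, and for each j : Fin s let ω_j(λ) be defined from A(λ) and λ by the standard off-block formula. Assume ∂_j A = [ω_j, A] on U for every j : Fin s. Then on U: (1) the sum over all j of ∂_j A is the zero matrix; (2) the sum over all j of λ(j)·∂_j A equals A·A^D − A^D·A, where A^D is the block-diagonal part of A. Blockwise, for p,q with π(p)=π(q) every ∂_j A_{pq} contribution to (2) reads (A_{[k,ℓ]}A_{[ℓ,ℓ]} − A_{[k,k]}A_{[k,ℓ]}) on the block (k,ℓ). -/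
open Matrix

/-- The matrices `ω j` sum to zero. -/
theorem sum_omM {n s : ℕ} (bk : Fin n → Fin s) (lam : Fin s → ℂ)
    (A : Matrix (Fin n) (Fin n) ℂ) : ∑ j, omM bk lam A j = 0 := by
  ext i k
  by_cases h : bk i = bk k
  · simp [Matrix.sum_apply, omM, h]
  · simp [Matrix.sum_apply, omM, h, ← Finset.sum_div, ← Finset.sum_mul]

/-- The sum of the matrices `ω j` weighted by `λ j` is the off-block part of `A`. -/
theorem sum_smul_omM {n s : ℕ} (bk : Fin n → Fin s) {lam : Fin s → ℂ}
    (hlam : ∀ a b : Fin s, a ≠ b → lam a ≠ lam b) (A : Matrix (Fin n) (Fin n) ℂ) :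
    ∑ j, lam j • omM bk lam A j = A - BD bk A := by
  ext i k
  by_cases h : bk i = bk k
  · simp [Matrix.sum_apply, omM, BD, h]
  · have hne : lam (bk i) - lam (bk k) ≠ 0 := sub_ne_zero.mpr (hlam _ _ h)
    simp [Matrix.sum_apply, omM, BD, h, mul_div_assoc', ← mul_assoc, ← Finset.sum_div,
      ← Finset.sum_mul, mul_sub, hne]

theorem statement15 {n s : ℕ} (hn : 0 < n) (hs : 0 < s) (bk : Fin n → Fin s)
    (U : Set (Fin s → ℂ)) (hU : IsOpen U)
    (hdist : ∀ x ∈ U, ∀ a b : Fin s, a ≠ b → x a ≠ x b)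
    (A : (Fin s → ℂ) → Matrix (Fin n) (Fin n) ℂ)
    (hA : ∀ p q : Fin n, DifferentiableOn ℂ (fun y => A y p q) U)
    -- the deformation equations ∂_j A = [ω_j, A] on U
    (hdef : ∀ j : Fin s, ∀ x ∈ U,
      pd A j x = omF bk A j x * A x - A x * omF bk A j x) :
    ∀ x ∈ U,
      -- (1) ∑_j ∂_j A = 0
      (∑ j : Fin s, pd A j x) = 0 ∧
      -- (2) ∑_j λ_j·∂_j A = A·A^D − A^D·A
      (∑ j : Fin s, x j • pd A j x) = A x * BD bk (A x) - BD bk (A x) * A x := by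
  intro x hx
  have hpd : ∀ j, pd A j x = omM bk x (A x) j * A x - A x * omM bk x (A x) j :=
    fun j => hdef j x hx
  constructor
  · simp_rw [hpd]
    rw [Finset.sum_sub_distrib, ← Finset.sum_mul, ← Finset.mul_sum, sum_omM, zero_mul,
      mul_zero, sub_zero]
  · have hsmul : ∀ j, x j • pd A j x =
        (x j • omM bk x (A x) j) * A x - A x * (x j • omM bk x (A x) j) := fun j => by
      rw [hpd, smul_sub, smul_mul_assoc, mul_smul_comm]
    simp_rw [hsmul]
    rw [Finset.sum_sub_distrib, ← Finset.sum_mul, ← Finset.mul_sum,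
      sum_smul_omM bk (hdist x hx)]
    noncomm_ring
end

section
/- Let m ≥ 2 be an integer, t₂ ∈ ℂ with t₂ ≠ 0, v ∈ ℂ, and η₁₁, η₁₂, a, b ∈ ℂ with a·b ≠ 0, a² = η₁₂ + t₂^{(m−2)/2}·η₁₁ and b² = η₁₂ − t₂^{(m−2)/2}·η₁₁ (principal complex powers). Let Ψ̂ = (1/√2)·[[a·t₂^{(2−m)/4}, a·t₂^{(m−2)/4}], [i·b·t₂^{(2−m)/4}, −i·b·t₂^{(m−2)/4}]]. Then conjugation of the skew-symmetric matrix [[0, v], [−v, 0]] by Ψ̂ gives Ψ̂⁻¹·[[0, v], [−v, 0]]·Ψ̂ = (i·v/(a·b))·[[η₁₂, t₂^{m−2}·η₁₁], [−η₁₁, −η₁₂]]. In particular this conjugate has eigenvalues ±i·v. -/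
open Matrix Complex Polynomial

/-- The matrix `Ψ̂` (with principal complex powers of `t₂`). -/
noncomputable def PsiHat (m : ℕ) (a b t₂ : ℂ) : Matrix (Fin 2) (Fin 2) ℂ :=
  ((Real.sqrt 2 : ℂ))⁻¹ •
    !![a * t₂ ^ (((2 : ℂ) - (m : ℂ)) / 4), a * t₂ ^ (((m : ℂ) - 2) / 4);
       Complex.I * b * t₂ ^ (((2 : ℂ) - (m : ℂ)) / 4),
       -(Complex.I * b) * t₂ ^ (((m : ℂ) - 2) / 4)]

theorem cpow_quarter_neg (m : ℕ) (t : ℂ) :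
    t ^ (((2 : ℂ) - (m : ℂ)) / 4) = (t ^ (((m : ℂ) - 2) / 4))⁻¹ := by
  rw [← cpow_neg]
  congr 1
  ring

theorem cpow_eq_quarter_sq (m : ℕ) (t : ℂ) :
    t ^ (((m : ℂ) - 2) / 2) = (t ^ (((m : ℂ) - 2) / 4)) ^ 2 := by
  rw [← cpow_nat_mul]
  congr 1
  push_cast
  ring

theorem cpow_eq_quarter_pow_four (m : ℕ) (t : ℂ) :
    t ^ ((m : ℂ) - 2) = (t ^ (((m : ℂ) - 2) / 4)) ^ 4 := by
  rw [← cpow_nat_mul]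
  congr 1
  push_cast
  ring

theorem det_PsiHat (m : ℕ) (a b : ℂ) {t : ℂ} (ht : t ≠ 0) :
    (PsiHat m a b t).det = -(Complex.I * a * b) := by
  have hp : t ^ (((m : ℂ) - 2) / 4) ≠ 0 := by simp [cpow_eq_zero_iff, ht]
  have hs : ((Real.sqrt 2 : ℂ))⁻¹ ^ 2 = 2⁻¹ := by
    rw [inv_pow, ← ofReal_pow, Real.sq_sqrt zero_le_two, ofReal_ofNat]
  rw [PsiHat, det_smul, Fintype.card_fin, hs, det_fin_two_of, cpow_quarter_neg]
  field_simp
  ring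

/-- The intertwining relation behind the conjugation formula for `PsiHat`. -/
theorem skew_mul_PsiHat (m : ℕ) (v : ℂ) {t η₁₁ η₁₂ a b : ℂ} (ht : t ≠ 0) (hab : a * b ≠ 0)
    (ha : a ^ 2 = η₁₂ + t ^ (((m : ℂ) - 2) / 2) * η₁₁)
    (hb : b ^ 2 = η₁₂ - t ^ (((m : ℂ) - 2) / 2) * η₁₁) :
    !![0, v; -v, 0] * PsiHat m a b t
      = PsiHat m a b t * ((Complex.I * v / (a * b)) •
          !![η₁₂, t ^ ((m : ℂ) - 2) * η₁₁; -η₁₁, -η₁₂]) := by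
  have hp : t ^ (((m : ℂ) - 2) / 4) ≠ 0 := by simp [cpow_eq_zero_iff, ht]
  obtain ⟨ha₀, hb₀⟩ := mul_ne_zero_iff.mp hab
  rw [cpow_eq_quarter_sq] at ha hb
  rw [PsiHat, cpow_quarter_neg, cpow_eq_quarter_pow_four, mul_smul_comm, smul_mul_assoc,
    mul_smul_comm]
  congr 1
  generalize t ^ (((m : ℂ) - 2) / 4) = p at *
  rw [mul_fin_two, mul_fin_two, smul_of, smul_cons, smul_cons, smul_cons]
  ext i j
  fin_cases i <;> fin_cases j <;> simp <;> field_simp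
  · linear_combination v * hb
  · linear_combination -v * hb
  · linear_combination -v * ha - v * (η₁₂ + p ^ 2 * η₁₁) * I_sq
  · linear_combination -v * ha - v * (η₁₂ + p ^ 2 * η₁₁) * I_sq

theorem charpoly_skew_fin_two (v : ℂ) :
    (!![0, v; -v, 0] : Matrix (Fin 2) (Fin 2) ℂ).charpoly
      = (Polynomial.X - Polynomial.C (Complex.I * v))
          * (Polynomial.X + Polynomial.C (Complex.I * v)) := by
  have hI : (C Complex.I : ℂ[X]) ^ 2 = -1 := by rw [← C_pow, I_sq, C_neg, C_1]
  rw [charpoly_fin_two, trace_fin_two_of, det_fin_two_of]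
  simp only [C_mul, C_sub, C_neg, C_add, C_0]
  linear_combination (C v) ^ 2 * hI

theorem statement18 (m : ℕ) (hm : 2 ≤ m) (t₂ v η₁₁ η₁₂ a b : ℂ) (ht₂ : t₂ ≠ 0)
    (hab : a * b ≠ 0)
    (ha : a ^ 2 = η₁₂ + t₂ ^ (((m : ℂ) - 2) / 2) * η₁₁)
    (hb : b ^ 2 = η₁₂ - t₂ ^ (((m : ℂ) - 2) / 2) * η₁₁) :
    (PsiHat m a b t₂)⁻¹ * !![0, v; -v, 0] * PsiHat m a b t₂
      = (Complex.I * v / (a * b)) •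
          !![η₁₂, t₂ ^ ((m : ℂ) - 2) * η₁₁; -η₁₁, -η₁₂]
    ∧ ((PsiHat m a b t₂)⁻¹ * !![0, v; -v, 0] * PsiHat m a b t₂).charpoly
        = (Polynomial.X - Polynomial.C (Complex.I * v))
            * (Polynomial.X + Polynomial.C (Complex.I * v)) := by
  have hdet : IsUnit (PsiHat m a b t₂).det := by
    rw [det_PsiHat m a b ht₂]
    simpa [mul_assoc] using hab
  refine ⟨?_, ?_⟩
  · rw [mul_assoc, skew_mul_PsiHat m v ht₂ hab ha hb, nonsing_inv_mul_cancel_left _ _ hdet]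
  · rw [← charpoly_skew_fin_two]
    exact charpoly_units_conj' ((PsiHat m a b t₂).nonsingInvUnit hdet) _
end
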